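/- arXiv:2012.14931 — 2 statements merged into one kernel-verified Lean document; each statement's English description precedes it below -/
import Mathlib

section
/- Let S be a finite block-group and let e, f be idempotents of S. Then (ef)^ω · e = (ef)^ω = f · (ef)^ω, where (ef)^ω denotes the unique idempotent power of ef. -/
/-- A (finite) semigroup is a block-group iff every element has at most one inverse. -/
def IsBlockGroup (S : Type*) [Semigroup S] : Prop :=
  ∀ a b c : S, a * b * a = a → b * a * b = b → a * c * a = a → c * a * c = c → b = c

/-- `a ≤_R b` : `a ∈ b S¹`. -/
def leR {S : Type*} [Semigroup S] (a b : S) : Prop := a = b ∨ ∃ x, a = b * x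

/-- `a ≤_L b` : `a ∈ S¹ b`. -/
def leL {S : Type*} [Semigroup S] (a b : S) : Prop := a = b ∨ ∃ x, a = x * b

/-- Green's relation ℛ : `a S¹ = b S¹`. -/
def RRel {S : Type*} [Semigroup S] (a b : S) : Prop := leR a b ∧ leR b a

/-- Green's relation ℒ : `S¹ a = S¹ b`. -/
def LRel {S : Type*} [Semigroup S] (a b : S) : Prop := leL a b ∧ leL b a

/-- An element is regular if `a y a = a` for some `y`. -/
def IsRegularElem {S : Type*} [Semigroup S] (a : S) : Prop := ∃ y, a * y * a = a

/-- `x ∈ 𝒟(s)` : `x = x e` for some idempotent `e ≤_R s`. -/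
def inD {S : Type*} [Semigroup S] (s x : S) : Prop :=
  ∃ e, e * e = e ∧ leR e s ∧ x = x * e

/-- `x ∈ ℐ(s)` : `x = x e` for some idempotent `e ≤_L s`. -/
def inI {S : Type*} [Semigroup S] (s x : S) : Prop :=
  ∃ e, e * e = e ∧ leL e s ∧ x = x * e

/-- `spow a n = a ^ (n+1)` : positive powers in a semigroup. -/
def spow {S : Type*} [Semigroup S] (a : S) : ℕ → S
  | 0 => a
  | n + 1 => spow a n * a

/-- Every positive power of `e * f`, with `e` idempotent, is fixed by `e` on the left. -/
theorem mul_spow_mul_of_idem {S : Type*} [Semigroup S] {e : S} (he : e * e = e) (f : S) (n : ℕ) :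
    e * spow (e * f) n = spow (e * f) n := by
  induction n with
  | zero => rw [spow, ← mul_assoc, he]
  | succ n ih => rw [spow, ← mul_assoc, ih]

/-- Every positive power of `e * f`, with `f` idempotent, is fixed by `f` on the right. -/
theorem spow_mul_mul_of_idem {S : Type*} [Semigroup S] (e : S) {f : S} (hf : f * f = f) (n : ℕ) :
    spow (e * f) n * f = spow (e * f) n := by
  cases n with
  | zero => rw [spow, mul_assoc, hf]
  | succ n => rw [spow, mul_assoc, mul_assoc, hf]

/-- Two `ℛ`-equivalent idempotents of a block-group coincide. -/
theorem IsBlockGroup.eq_of_mul_eq_right {S : Type*} [Semigroup S] (hS : IsBlockGroup S) {g h : S}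
    (hg : g * g = g) (hgh : g * h = h) (hhg : h * g = g) : h = g :=
  hS g h g (by rw [hgh, hhg]) (by rw [hhg, hgh]) (by rw [hg, hg]) (by rw [hg, hg])

/-- Two `ℒ`-equivalent idempotents of a block-group coincide. -/
theorem IsBlockGroup.eq_of_mul_eq_left {S : Type*} [Semigroup S] (hS : IsBlockGroup S) {g h : S}
    (hg : g * g = g) (hh : h * h = h) (hgh : g * h = g) (hhg : h * g = h) : h = g :=
  hS g h g (by rw [hgh, hg]) (by rw [hhg, hh]) (by rw [hg, hg]) (by rw [hg, hg])

theorem stmt_7 {S : Type*} [Semigroup S] [Fintype S] (hS : IsBlockGroup S)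
    (e f : S) (he : e * e = e) (hf : f * f = f) :
    ∀ g : S, (∃ n : ℕ, g = spow (e * f) n) → g * g = g →
      g * e = g ∧ f * g = g := by
  rintro g ⟨n, rfl⟩ hg
  have heg := mul_spow_mul_of_idem he f n
  have hgf := spow_mul_mul_of_idem e hf n
  set g := spow (e * f) n
  refine ⟨hS.eq_of_mul_eq_right hg ?_ ?_, hS.eq_of_mul_eq_left hg ?_ ?_ ?_⟩
  · rw [← mul_assoc, hg]
  · rw [mul_assoc, heg, hg]
  · rw [mul_assoc, ← mul_assoc g f g, hgf, hg]
  · rw [← mul_assoc, hgf, hg]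
  · rw [mul_assoc, hg]
end

section
/- Let S be a finite block-group and let ρ be a congruence on S that separates regular elements (i.e. whenever a, b are regular elements of S with a ρ b, then a = b). If s ρ t, then ℛ(s) = ℛ(t). -/
/-- Every nonempty subset of a finite semigroup that is closed under multiplication
contains an idempotent. -/
theorem exists_idempotent_mem_of_finite {S : Type*} [Semigroup S] [Finite S] (K : Set S)
    (hne : K.Nonempty) (hmul : ∀ x ∈ K, ∀ y ∈ K, x * y ∈ K) : ∃ f ∈ K, f * f = f := by
  let _ : TopologicalSpace S := ⊥
  have : DiscreteTopology S := ⟨rfl⟩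
  exact exists_idempotent_in_compact_subsemigroup
    (fun _ => continuous_of_discreteTopology) K hne K.toFinite.isCompact hmul

/-- If a congruence on a finite semigroup separates regular elements, then every idempotent
`≤_R`-below `s` is also `≤_R`-below any element congruent to `s`. -/
theorem leR_of_congruent {S : Type*} [Semigroup S] [Finite S]
    (ρ : S → S → Prop) (hEquiv : Equivalence ρ)
    (hleft : ∀ a b c : S, ρ a b → ρ (c * a) (c * b))
    (hright : ∀ a b c : S, ρ a b → ρ (a * c) (b * c))
    (hsep : ∀ a b : S, IsRegularElem a → IsRegularElem b → ρ a b → a = b)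
    {s t e : S} (hst : ρ s t) (he : e * e = e) (hes : leR e s) : leR e t := by
  obtain ⟨x, hx⟩ : ∃ x, e = s * x := by
    rcases hes with rfl | h
    · exact ⟨e, he.symm⟩
    · exact h
  obtain ⟨f, ⟨hfe, y, hy⟩, hf⟩ :=
    exists_idempotent_mem_of_finite {f : S | ρ f e ∧ ∃ y, f = t * y}
      ⟨t * x, hx ▸ hright _ _ _ (hEquiv.symm hst), x, rfl⟩
      (by
        rintro a ⟨ha, y, rfl⟩ b ⟨hb, -⟩
        have h := hEquiv.trans (hright _ _ b ha) (hleft _ _ e hb)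
        exact ⟨he ▸ h, y * b, mul_assoc _ _ _⟩)
  have hef : f = e := hsep f e ⟨f, by rw [hf, hf]⟩ ⟨e, by rw [he, he]⟩ hfe
  exact Or.inr ⟨y, hef ▸ hy⟩

theorem stmt_17 {S : Type*} [Semigroup S] [Fintype S] (hS : IsBlockGroup S)
    (ρ : S → S → Prop) (hEquiv : Equivalence ρ)
    (hleft : ∀ a b c : S, ρ a b → ρ (c * a) (c * b))
    (hright : ∀ a b c : S, ρ a b → ρ (a * c) (b * c))
    (hsep : ∀ a b : S, IsRegularElem a → IsRegularElem b → ρ a b → a = b)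
    (s t : S) (hst : ρ s t) :
    ∀ e : S, e * e = e → (leR e s ↔ leR e t) := by
  intro e he
  exact ⟨leR_of_congruent ρ hEquiv hleft hright hsep hst he,
    leR_of_congruent ρ hEquiv hleft hright hsep (hEquiv.symm hst) he⟩
end
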